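/- Let Ȧ = ℂ[t₁^{±1},...,t_m^{±1}], k̇ = Der(Ȧ), and g = Ȧ ⊕ k̇ the associated quasi-Poisson algebra of the Lie–Rinehart pair (Ȧ, k̇). Then the Lie algebra L(g) = ℂ[t₀^{±1}] ⊗ g with bracket [t₀^r ⊗ x, t₀^s ⊗ y] = t₀^{r+s} ⊗ ({x,y} − r·x·π(y) + s·π(x)·y) is isomorphic to Der(ℂ[t₀^{±1},...,t_m^{±1}]), via t₀^r ⊗ a ↦ t₀^r a (t₀ d/dt₀) for a ∈ Ȧ and t₀^r ⊗ δ ↦ t₀^r δ for δ ∈ k̇. -/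

import Mathlib

/-- `Ȧ = ℂ[t₁^{±1},…,t_m^{±1}]`, the Laurent polynomial ring in `m` variables. -/
abbrev LaurentDot (m : ℕ) : Type := AddMonoidAlgebra ℂ (Fin m →₀ ℤ)

/-- `A = ℂ[t₀^{±1},…,t_m^{±1}]`, the Laurent polynomial ring in `m+1` variables. -/
abbrev LaurentFull (m : ℕ) : Type := AddMonoidAlgebra ℂ (Fin (m + 1) →₀ ℤ)

/-- Monomials of `A`. -/
noncomputable def tf (m : ℕ) (r : Fin (m + 1) →₀ ℤ) : LaurentFull m :=
  AddMonoidAlgebra.single r 1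

/-- The embedding `Ȧ → A` induced by relabelling the variables `t_i ↦ t_{i+1}`
(i.e. viewing `Ȧ` as the subalgebra not involving `t₀`). -/
noncomputable def iotaDot (m : ℕ) : LaurentDot m →ₐ[ℂ] LaurentFull m :=
  AddMonoidAlgebra.mapDomainAlgHom ℂ ℂ
    (Finsupp.mapDomain.addMonoidHom (Fin.succ : Fin m → Fin (m + 1)))

section

variable {m : ℕ}

/-- The commutative product on `g = Ȧ ⊕ Der(Ȧ)`. -/
noncomputable def gMul (x y : LaurentDot m × Derivation ℂ (LaurentDot m) (LaurentDot m)) :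
    LaurentDot m × Derivation ℂ (LaurentDot m) (LaurentDot m) :=
  (x.1 * y.1, x.1 • y.2 + y.1 • x.2)

/-- The Lie bracket on `g = Ȧ ⊕ Der(Ȧ)`:
`{a⊕δ, b⊕σ} = (δ(b) − σ(a)) ⊕ [δ,σ]`. -/
noncomputable def gBracket (x y : LaurentDot m × Derivation ℂ (LaurentDot m) (LaurentDot m)) :
    LaurentDot m × Derivation ℂ (LaurentDot m) (LaurentDot m) :=
  (x.2 y.1 - y.2 x.1, ⁅x.2, y.2⁆)

/-- The degree-component of the bracket of `L(g) = ℂ[t₀^{±1}] ⊗ g`. -/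
noncomputable def lBracket (r : ℤ) (x : LaurentDot m × Derivation ℂ (LaurentDot m) (LaurentDot m))
    (s : ℤ) (y : LaurentDot m × Derivation ℂ (LaurentDot m) (LaurentDot m)) :
    LaurentDot m × Derivation ℂ (LaurentDot m) (LaurentDot m) :=
  gBracket x y - r • gMul x (y.1, 0) + s • gMul (x.1, 0) y

end

namespace AddMonoidAlgebra

variable {k G : Type*} [CommRing k] [AddCommGroup G]

lemma constr_basis_single (φ : G → AddMonoidAlgebra k G) (s : G) (c : k) :
    (AddMonoidAlgebra.basis G k).constr k (fun s ↦ φ s * single s 1) (single s c) =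
      φ s * single s c := by
  have hs : (single s c : AddMonoidAlgebra k G) = c • AddMonoidAlgebra.basis G k s := by
    simp
  rw [hs, map_smul, Module.Basis.constr_basis, mul_smul_comm, basis_apply]

/-- The derivation of `k[G]` acting on the monomial `t^s` by `t^s ↦ φ(s) t^s`. -/
noncomputable def derivationOfHom (φ : G →+ AddMonoidAlgebra k G) :
    Derivation k (AddMonoidAlgebra k G) (AddMonoidAlgebra k G) :=
  Derivation.mk' ((AddMonoidAlgebra.basis G k).constr k fun s ↦ φ s * single s 1) <| by
    intro a b
    induction a using AddMonoidAlgebra.induction_linear with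
    | zero => simp
    | add x y hx hy => simp only [add_mul, map_add, hx, hy, add_smul, smul_add]; abel
    | single s c =>
      induction b using AddMonoidAlgebra.induction_linear with
      | zero => simp
      | add x y hx hy => simp only [mul_add, map_add, hx, hy, add_smul, smul_add]; abel
      | single t d =>
        rw [single_mul_single, constr_basis_single, constr_basis_single, constr_basis_single,
          map_add, ← single_mul_single]
        simp only [smul_eq_mul]
        ring

lemma derivationOfHom_single (φ : G →+ AddMonoidAlgebra k G) (s : G) (c : k) :
    derivationOfHom φ (single s c) = φ s * single s c :=
  constr_basis_single φ s c

/-- The logarithmic derivative `s ↦ t^{-s} D(t^s)` attached to a derivation `D` of `k[G]`. -/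
noncomputable def logDeriv (D : Derivation k (AddMonoidAlgebra k G) (AddMonoidAlgebra k G)) :
    G →+ AddMonoidAlgebra k G :=
  AddMonoidHom.mk' (fun s ↦ single (-s) 1 * D (single s 1)) fun s t ↦ by
    have hs : (single (-s) 1 * single s 1 : AddMonoidAlgebra k G) = 1 := by
      simp [single_mul_single, one_def]
    have ht : (single (-t) 1 * single t 1 : AddMonoidAlgebra k G) = 1 := by
      simp [single_mul_single, one_def]
    have h1 : (single (s + t) 1 : AddMonoidAlgebra k G) = single s 1 * single t 1 := by
      simp [single_mul_single]
    have h2 : (single (-(s + t)) 1 : AddMonoidAlgebra k G) = single (-s) 1 * single (-t) 1 := by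
      simp [single_mul_single, add_comm]
    rw [h1, h2, Derivation.leibniz, smul_eq_mul, smul_eq_mul]
    linear_combination (single (-t) 1 * D (single t 1)) * hs + (single (-s) 1 * D (single s 1)) * ht

lemma logDeriv_mul_single (D : Derivation k (AddMonoidAlgebra k G) (AddMonoidAlgebra k G))
    (s : G) (c : k) : logDeriv D s * single s c = D (single s c) := by
  have hs : (single s c : AddMonoidAlgebra k G) = c • single s 1 := by simp
  have h1 : (single (-s) 1 * single s 1 : AddMonoidAlgebra k G) = 1 := by
    simp [single_mul_single, one_def]
  rw [hs, Derivation.map_smul, mul_smul_comm]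
  congr 1
  simp only [logDeriv, AddMonoidHom.mk'_apply]
  linear_combination D (single s 1) * h1

lemma derivation_ext {D₁ D₂ : Derivation k (AddMonoidAlgebra k G) (AddMonoidAlgebra k G)}
    (h : ∀ s c, D₁ (single s c) = D₂ (single s c)) : D₁ = D₂ := by
  ext1 a
  induction a using AddMonoidAlgebra.induction_linear with
  | zero => simp
  | add x y hx hy => simp [hx, hy]
  | single s c => exact h s c

end AddMonoidAlgebra

section

open AddMonoidAlgebra

variable {m : ℕ}

lemma iotaDot_single (u : Fin m →₀ ℤ) (c : ℂ) :
    iotaDot m (single u c) = single (u.mapDomain Fin.succ) c := by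
  simp [iotaDot]

lemma tf_add (r s : Fin (m + 1) →₀ ℤ) : tf m (r + s) = tf m r * tf m s := by
  simp [tf, single_mul_single]

lemma single_zero_add_mapDomain_succ (s : Fin (m + 1) →₀ ℤ) :
    Finsupp.single 0 (s 0) + (s.comapDomain Fin.succ (Fin.succ_injective m).injOn).mapDomain
      Fin.succ = s := by
  ext i
  refine Fin.cases ?_ (fun j ↦ ?_) i
  · simp [Finsupp.mapDomain_of_notMem_range]
  · simp [Finsupp.mapDomain_apply (Fin.succ_injective m)]

lemma comapDomain_succ_eq (n : ℤ) (u : Fin m →₀ ℤ) :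
    (Finsupp.single 0 n + u.mapDomain Fin.succ).comapDomain Fin.succ
      (Fin.succ_injective m).injOn = u := by
  ext j
  simp [Finsupp.mapDomain_apply (Fin.succ_injective m)]

lemma single_zero_add_mapDomain_succ_apply_zero (n : ℤ) (u : Fin m →₀ ℤ) :
    (Finsupp.single (0 : Fin (m + 1)) n + u.mapDomain Fin.succ) 0 = n := by
  simp [Finsupp.mapDomain_of_notMem_range]

lemma tf_mul_iotaDot_single (n : ℤ) (u : Fin m →₀ ℤ) (c : ℂ) :
    tf m (Finsupp.single 0 n) * iotaDot m (single u c) =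
      single (Finsupp.single 0 n + u.mapDomain Fin.succ) c := by
  simp [iotaDot_single, tf, single_mul_single]

lemma single_eq_tf_mul_iotaDot (s : Fin (m + 1) →₀ ℤ) (c : ℂ) :
    single s c = tf m (Finsupp.single 0 (s 0)) *
      iotaDot m (single (s.comapDomain Fin.succ (Fin.succ_injective m).injOn) c) := by
  rw [tf_mul_iotaDot_single, single_zero_add_mapDomain_succ]

/-- Two derivations of `A` agreeing on all `t₀^n b` with `b ∈ Ȧ` are equal. -/
lemma derivation_ext_tf_mul_iotaDot {D₁ D₂ : Derivation ℂ (LaurentFull m) (LaurentFull m)}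
    (h : ∀ n b, D₁ (tf m (Finsupp.single 0 n) * iotaDot m b) =
      D₂ (tf m (Finsupp.single 0 n) * iotaDot m b)) : D₁ = D₂ :=
  derivation_ext fun s c ↦ by rw [single_eq_tf_mul_iotaDot, h]

/-- The derivation `t₀^r (a t₀ d/dt₀ + δ)` of `A` attached to `t₀^r ⊗ (a ⊕ δ)`. -/
noncomputable def loopDerivation (r : ℤ)
    (x : LaurentDot m × Derivation ℂ (LaurentDot m) (LaurentDot m)) :
    Derivation ℂ (LaurentFull m) (LaurentFull m) :=
  derivationOfHom <| AddMonoidHom.mk' (fun s ↦ tf m (Finsupp.single 0 r) *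
    (s 0 • iotaDot m x.1 + iotaDot m
      (logDeriv x.2 (s.comapDomain Fin.succ (Fin.succ_injective m).injOn)))) fun s t ↦ by
    have h : (s + t).comapDomain Fin.succ (Fin.succ_injective m).injOn =
        s.comapDomain Fin.succ (Fin.succ_injective m).injOn +
          t.comapDomain Fin.succ (Fin.succ_injective m).injOn := by
      ext; simp
    rw [h, map_add, map_add, Finsupp.add_apply, add_smul]
    ring

lemma loopDerivation_apply (r n : ℤ)
    (x : LaurentDot m × Derivation ℂ (LaurentDot m) (LaurentDot m)) (b : LaurentDot m) :
    loopDerivation r x (tf m (Finsupp.single 0 n) * iotaDot m b) =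
      tf m (Finsupp.single 0 (r + n)) * iotaDot m (n • (x.1 * b) + x.2 b) := by
  induction b using AddMonoidAlgebra.induction_linear with
  | zero => simp
  | add x y hx hy =>
    simp only [mul_add, map_add, hx, hy, smul_add]
    ring
  | single u c =>
    rw [tf_mul_iotaDot_single, loopDerivation, derivationOfHom_single, AddMonoidHom.mk'_apply,
      comapDomain_succ_eq, single_zero_add_mapDomain_succ_apply_zero, ← tf_mul_iotaDot_single,
      ← logDeriv_mul_single x.2, Finsupp.single_add, tf_add]
    simp only [map_add, map_mul, map_intCast, zsmul_eq_mul]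
    ring

lemma loopDerivation_single (r : ℤ)
    (x : LaurentDot m × Derivation ℂ (LaurentDot m) (LaurentDot m)) (s : Fin (m + 1) →₀ ℤ)
    (c : ℂ) :
    loopDerivation r x (single s c) = tf m (Finsupp.single 0 (r + s 0)) *
      iotaDot m (s 0 • (x.1 * single (s.comapDomain Fin.succ (Fin.succ_injective m).injOn) c) +
        x.2 (single (s.comapDomain Fin.succ (Fin.succ_injective m).injOn) c)) := by
  conv_lhs => rw [single_eq_tf_mul_iotaDot, loopDerivation_apply]

/-- `loopDerivation` as a linear map on `L(g)`. -/
noncomputable def loopDerivationLinear (m : ℕ) :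
    (ℤ →₀ (LaurentDot m × Derivation ℂ (LaurentDot m) (LaurentDot m))) →ₗ[ℂ]
      Derivation ℂ (LaurentFull m) (LaurentFull m) :=
  Finsupp.lsum ℂ fun r ↦
    { toFun := loopDerivation r
      map_add' := fun x y ↦ derivation_ext_tf_mul_iotaDot fun n b ↦ by
        simp only [Derivation.add_apply, loopDerivation_apply, Prod.fst_add, Prod.snd_add,
          map_add, add_mul, smul_add]
        ring
      map_smul' := fun c x ↦ derivation_ext_tf_mul_iotaDot fun n b ↦ by
        simp only [Derivation.smul_apply, loopDerivation_apply, Prod.smul_fst, Prod.smul_snd,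
          RingHom.id_apply, smul_mul_assoc, smul_comm n c, ← smul_add, map_smul, mul_smul_comm] }

lemma loopDerivationLinear_single (r : ℤ)
    (x : LaurentDot m × Derivation ℂ (LaurentDot m) (LaurentDot m)) :
    loopDerivationLinear m (Finsupp.single r x) = loopDerivation r x := by
  rw [loopDerivationLinear, Finsupp.lsum_single]
  rfl

lemma loopDerivation_lBracket (r s : ℤ)
    (x y : LaurentDot m × Derivation ℂ (LaurentDot m) (LaurentDot m)) :
    loopDerivation (r + s) (lBracket r x s y) = ⁅loopDerivation r x, loopDerivation s y⁆ := by
  refine derivation_ext_tf_mul_iotaDot fun n b ↦ ?_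
  rw [Derivation.commutator_apply]
  simp only [loopDerivation_apply]
  rw [show s + (r + n) = r + s + n by ring, show r + (s + n) = r + s + n by ring, ← mul_sub,
    ← map_sub]
  congr 2
  simp only [lBracket, gBracket, gMul, Prod.fst_add, Prod.fst_sub, Prod.snd_add, Prod.snd_sub,
    Prod.smul_fst, Prod.smul_snd, Derivation.add_apply, Derivation.sub_apply,
    Derivation.smul_apply, Derivation.commutator_apply, smul_zero, zero_add, add_zero, map_add,
    Derivation.leibniz, Derivation.map_intCast, smul_eq_mul, zsmul_eq_mul, Int.cast_add]
  ring

lemma coeff_tf_mul_iotaDot (r n : ℤ) (b : LaurentDot m) (u : Fin m →₀ ℤ) :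
    (tf m (Finsupp.single 0 r) * iotaDot m b).coeff
      (Finsupp.single 0 n + u.mapDomain Fin.succ) = if r = n then b.coeff u else 0 := by
  classical
  induction b using AddMonoidAlgebra.induction_linear with
  | zero => simp
  | add x y hx hy =>
    simp only [mul_add, map_add, coeff_add, Finsupp.add_apply, hx, hy]
    split_ifs <;> simp
  | single v c =>
    rw [tf_mul_iotaDot_single, coeff_single, coeff_single, Finsupp.single_apply,
      Finsupp.single_apply, ← ite_and]
    refine if_congr ⟨fun h ↦ ⟨?_, ?_⟩, fun h ↦ by rw [h.1, h.2]⟩ rfl rfl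
    · rw [← single_zero_add_mapDomain_succ_apply_zero r v, h,
        single_zero_add_mapDomain_succ_apply_zero]
    · rw [← comapDomain_succ_eq r v, h, comapDomain_succ_eq]

lemma coeff_loopDerivationLinear
    (f : ℤ →₀ (LaurentDot m × Derivation ℂ (LaurentDot m) (LaurentDot m))) (r n : ℤ)
    (b : LaurentDot m) (u : Fin m →₀ ℤ) :
    (loopDerivationLinear m f (tf m (Finsupp.single 0 n) * iotaDot m b)).coeff
      (Finsupp.single 0 (r + n) + u.mapDomain Fin.succ) =
      (n • ((f r).1 * b) + (f r).2 b).coeff u := by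
  classical
  induction f using Finsupp.induction_linear with
  | zero => simp
  | add f g hf hg =>
    simp only [map_add, Derivation.add_apply, coeff_add, Finsupp.add_apply, hf, hg, Prod.fst_add,
      Prod.snd_add, add_mul, smul_add]
    ring
  | single q x =>
    rw [loopDerivationLinear_single, loopDerivation_apply, coeff_tf_mul_iotaDot]
    by_cases h : q = r
    · simp [h]
    · simp [h, Finsupp.single_eq_of_ne' h]

lemma loopDerivationLinear_injective : Function.Injective (loopDerivationLinear m) := by
  refine (injective_iff_map_eq_zero _).2 fun f hf ↦ ?_
  have key (r n : ℤ) (b : LaurentDot m) : n • ((f r).1 * b) + (f r).2 b = 0 := by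
    ext u
    rw [← coeff_loopDerivationLinear, hf]
    simp
  ext1 r
  refine Prod.ext ?_ (Derivation.ext fun b ↦ ?_)
  · simpa using key r 1 1
  · simpa using key r 0 b

lemma derivationOfHom_mem_range (i : Fin (m + 1)) (a : LaurentFull m) :
    derivationOfHom ((AddMonoidHom.mulRight a).comp ((Int.castAddHom (LaurentFull m)).comp
      (Finsupp.applyAddHom i))) ∈ LinearMap.range (loopDerivationLinear m) := by
  have hsingle (s : Fin (m + 1) →₀ ℤ) (c : ℂ) (a : LaurentFull m) :
      derivationOfHom ((AddMonoidHom.mulRight a).comp ((Int.castAddHom (LaurentFull m)).comp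
        (Finsupp.applyAddHom i))) (single s c) = s i * a * single s c := by
    simp [derivationOfHom_single]
  induction a using AddMonoidAlgebra.induction_linear with
  | zero =>
    convert Submodule.zero_mem _
    exact derivation_ext fun s c ↦ by simp [hsingle]
  | add x y hx hy =>
    convert Submodule.add_mem _ hx hy
    exact derivation_ext fun s c ↦ by simp only [Derivation.add_apply, hsingle]; ring
  | single t d =>
    obtain rfl | ⟨j, rfl⟩ := i.eq_zero_or_eq_succ
    · refine ⟨Finsupp.single (t 0)
        (single (t.comapDomain Fin.succ (Fin.succ_injective m).injOn) d, 0),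
        derivation_ext fun s c ↦ ?_⟩
      rw [loopDerivationLinear_single, loopDerivation_single, hsingle,
        single_eq_tf_mul_iotaDot t, single_eq_tf_mul_iotaDot s c, Finsupp.single_add, tf_add]
      simp only [Derivation.zero_apply, add_zero, map_mul, map_intCast, zsmul_eq_mul]
      ring
    · refine ⟨Finsupp.single (t 0) (0, derivationOfHom
        ((AddMonoidHom.mulRight (single (t.comapDomain Fin.succ (Fin.succ_injective m).injOn) d :
          LaurentDot m)).comp ((Int.castAddHom (LaurentDot m)).comp (Finsupp.applyAddHom j)))),
        derivation_ext fun s c ↦ ?_⟩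
      rw [loopDerivationLinear_single, loopDerivation_single, hsingle,
        single_eq_tf_mul_iotaDot t, single_eq_tf_mul_iotaDot s c, Finsupp.single_add, tf_add]
      simp only [derivationOfHom_single, zero_mul, smul_zero, zero_add, map_mul,
        AddMonoidHom.comp_apply, AddMonoidHom.mulRight_apply, Finsupp.applyAddHom_apply,
        Int.coe_castAddHom, map_intCast, Finsupp.comapDomain_apply]
      ring

lemma loopDerivationLinear_surjective : Function.Surjective (loopDerivationLinear m) := by
  intro D
  have hD : D = ∑ i, derivationOfHom ((AddMonoidHom.mulRight (logDeriv D (Finsupp.single i 1))).comp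
      ((Int.castAddHom (LaurentFull m)).comp (Finsupp.applyAddHom i))) := by
    refine derivation_ext fun s c ↦ ?_
    have hs : logDeriv D s = ∑ i, s i • logDeriv D (Finsupp.single i 1) := by
      conv_lhs => rw [← Finsupp.univ_sum_single s, map_sum]
      refine Finset.sum_congr rfl fun i _ ↦ ?_
      rw [← map_zsmul]
      simp
    rw [← logDeriv_mul_single, hs, Finset.sum_mul, ← Derivation.coeFnAddMonoidHom_apply, map_sum,
      Finset.sum_apply]
    exact Finset.sum_congr rfl fun i _ ↦ by simp [derivationOfHom_single]
  rw [hD]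
  exact Submodule.sum_mem _ fun i _ ↦ derivationOfHom_mem_range i _

end

/-- The Lie algebra `L(g) = ℂ[t₀^{±1}] ⊗ g` (modelled as `ℤ →₀ g`, with `t₀^r ⊗ x`
corresponding to `Finsupp.single r x`) is isomorphic to `Der(ℂ[t₀^{±1},…,t_m^{±1}])`:
there is a ℂ-linear equivalence intertwining the brackets, which sends `t₀^r ⊗ a`
(for `a ∈ Ȧ`) to the derivation `t₀^r a (t₀ d/dt₀)` and `t₀^r ⊗ δ` (for `δ ∈ Der(Ȧ)`)
to `t₀^r δ`, the latter two being characterized by their values on monomials `t^s c`. -/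
theorem lg_iso_der (m : ℕ) :
    ∃ e : (ℤ →₀ (LaurentDot m × Derivation ℂ (LaurentDot m) (LaurentDot m))) ≃ₗ[ℂ]
        Derivation ℂ (LaurentFull m) (LaurentFull m),
      (∀ (r s : ℤ) (x y : LaurentDot m × Derivation ℂ (LaurentDot m) (LaurentDot m)),
        e (Finsupp.single (r + s) (lBracket r x s y)) =
          ⁅e (Finsupp.single r x), e (Finsupp.single s y)⁆) ∧
      (∀ (r : ℤ) (a : LaurentDot m) (s : Fin (m + 1) →₀ ℤ) (c : ℂ),
        e (Finsupp.single r (a, 0)) (AddMonoidAlgebra.single s c) =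
          (s 0) • (tf m (Finsupp.single 0 r) * iotaDot m a * AddMonoidAlgebra.single s c)) ∧
      (∀ (r : ℤ) (δ : Derivation ℂ (LaurentDot m) (LaurentDot m))
          (s : Fin (m + 1) →₀ ℤ) (c : ℂ),
        e (Finsupp.single r (0, δ)) (AddMonoidAlgebra.single s c) =
          tf m (Finsupp.single 0 (r + s 0)) *
            iotaDot m (δ (AddMonoidAlgebra.single
              (Finsupp.comapDomain Fin.succ s (Fin.succ_injective m).injOn) c))) := by
  have hbij : Function.Bijective (loopDerivationLinear m) :=
    ⟨loopDerivationLinear_injective, loopDerivationLinear_surjective⟩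
  refine ⟨LinearEquiv.ofBijective (loopDerivationLinear m) hbij,
    fun r s x y ↦ ?_, fun r a s c ↦ ?_, fun r δ s c ↦ ?_⟩
  · simp only [LinearEquiv.ofBijective_apply, loopDerivationLinear_single]
    exact loopDerivation_lBracket r s x y
  · rw [LinearEquiv.ofBijective_apply, loopDerivationLinear_single, loopDerivation_single,
      single_eq_tf_mul_iotaDot s c, Finsupp.single_add, tf_add]
    simp only [Derivation.zero_apply, add_zero, map_mul, map_intCast, zsmul_eq_mul]
    ring
  · rw [LinearEquiv.ofBijective_apply, loopDerivationLinear_single, loopDerivation_single]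
    simp
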